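/- arXiv:1508.05034 — 5 statements merged into one kernel-verified Lean document; each statement's English description precedes it below -/
import Mathlib

section
/- Suppose the protocol ẋ(t) = −L[A(t)]x(t) establishes modulus consensus, i.e. for every solution there exists x* ≥ 0 with lim_{t→∞}|x_i(t)| = x* for every i. Then there exist a vector v ∈ ℝ^N and a vector ρ ∈ {−1,+1}^N such that every solution satisfies lim_{t→∞} x(t) = ρ (vᵀ x(0)); equivalently, the fundamental matrix Φ(t) (with Φ(0) = I) converges to the rank-one matrix ρ vᵀ as t → ∞. -/
open MeasureTheory Filter Matrix Finset Topology

/-- The signed Laplacian `L[A]` of a signed adjacency matrix: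
off-diagonal entries `L j k = -A j k`, diagonal entries `L j j = ∑ m, |A j m|`. -/
noncomputable def sLap {N : ℕ} (A : Matrix (Fin N) (Fin N) ℝ) : Matrix (Fin N) (Fin N) ℝ :=
  fun j k => if j = k then ∑ m, |A j m| else -A j k

/-- A time-varying signed adjacency matrix: entrywise measurable, locally bounded,
with zero diagonal. -/
def IsAdjacency {N : ℕ} (A : ℝ → Matrix (Fin N) (Fin N) ℝ) : Prop :=
  (∀ j k, Measurable fun t => A t j k) ∧
  (∀ T : ℝ, ∃ C : ℝ, ∀ t ∈ Set.Icc (0:ℝ) T, ∀ j k, |A t j k| ≤ C) ∧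
  (∀ t j, A t j j = 0)

/-- A solution of `ẋ = −L[A(t)]x` on `[0,∞)`: continuous and satisfying the integral
equation (equivalently, locally absolutely continuous and satisfying the ODE a.e.). -/
def IsSolution {N : ℕ} (A : ℝ → Matrix (Fin N) (Fin N) ℝ) (x : ℝ → Fin N → ℝ) : Prop :=
  ContinuousOn x (Set.Ici 0) ∧
  ∀ t ∈ Set.Ici (0:ℝ), ∀ j,
    x t j = x 0 j + ∫ s in (0:ℝ)..t, -((sLap (A s)).mulVec (x s) j)

/-- Quasi-strong connectivity of the static signed graph `G[A]`: some root reaches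
every node along arcs `k → j` present whenever `A j k ≠ 0`. -/
def QSC {N : ℕ} (A : Matrix (Fin N) (Fin N) ℝ) : Prop :=
  ∃ r : Fin N, ∀ j : Fin N, Relation.ReflTransGen (fun k j => A j k ≠ 0) r j

/-- Structural balance of the static signed graph `G[A]`: the nodes split into the camp `S`
and its complement (one possibly empty), with nonnegative weights inside a camp and
nonpositive weights between camps. -/
def StructBal {N : ℕ} (A : Matrix (Fin N) (Fin N) ℝ) : Prop :=
  ∃ S : Set (Fin N), ∀ j k : Fin N,
    ((j ∈ S ↔ k ∈ S) → 0 ≤ A j k) ∧ (¬(j ∈ S ↔ k ∈ S) → A j k ≤ 0)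

/-- `∫_0^∞ |a_{jk}(t)| dt = ∞`: arc `k → j` of the graph of essential interactions. -/
def EssArc {N : ℕ} (A : ℝ → Matrix (Fin N) (Fin N) ℝ) (j k : Fin N) : Prop :=
  ∫⁻ t in Set.Ici (0:ℝ), ENNReal.ofReal |A t j k| = ⊤

/-- `∫_0^∞ a_{jk}⁺(t) dt = ∞`: agents `j` and `k` essentially cooperate. -/
def EssPlus {N : ℕ} (A : ℝ → Matrix (Fin N) (Fin N) ℝ) (j k : Fin N) : Prop :=
  ∫⁻ t in Set.Ici (0:ℝ), ENNReal.ofReal (max (A t j k) 0) = ⊤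

/-- `∫_0^∞ a_{jk}⁻(t) dt = ∞`: agents `j` and `k` essentially compete. -/
def EssMinus {N : ℕ} (A : ℝ → Matrix (Fin N) (Fin N) ℝ) (j k : Fin N) : Prop :=
  ∫⁻ t in Set.Ici (0:ℝ), ENNReal.ofReal (max (-(A t j k)) 0) = ⊤

/-- Reachability from `u` to `v` in the graph of essential interactions. -/
def EssReach {N : ℕ} (A : ℝ → Matrix (Fin N) (Fin N) ℝ) (u v : Fin N) : Prop :=
  Relation.ReflTransGen (fun k j => EssArc A j k) u v

/-- Uniform strong connectivity of the time-varying graph `G[A(·)]`. -/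
def USC {N : ℕ} (A : ℝ → Matrix (Fin N) (Fin N) ℝ) : Prop :=
  ∃ T > (0:ℝ), ∃ ε > (0:ℝ), ∀ t ≥ (0:ℝ), ∀ u v : Fin N,
    Relation.ReflTransGen (fun k j => ε ≤ ∫ s in t..(t + T), |A s j k|) u v

/-- Uniform quasi-strong connectivity of the time-varying graph `G[A(·)]`. -/
def UQSC {N : ℕ} (A : ℝ → Matrix (Fin N) (Fin N) ℝ) : Prop :=
  ∃ T > (0:ℝ), ∃ ε > (0:ℝ), ∀ t ≥ (0:ℝ), ∃ r : Fin N, ∀ j : Fin N,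
    Relation.ReflTransGen (fun k j => ε ≤ ∫ s in t..(t + T), |A s j k|) r j

/-- Cut-balance of the time-varying graph `G[A(·)]` with some constant `K ≥ 1`. -/
def CutBalanced {N : ℕ} (A : ℝ → Matrix (Fin N) (Fin N) ℝ) : Prop :=
  ∃ K : ℝ, 1 ≤ K ∧ ∀ᵐ t ∂(volume.restrict (Set.Ici (0:ℝ))),
    ∀ V : Finset (Fin N), V.Nonempty → V ≠ Finset.univ →
      K⁻¹ * (∑ j ∈ V, ∑ k ∈ Vᶜ, |A t k j|) ≤ (∑ j ∈ V, ∑ k ∈ Vᶜ, |A t j k|) ∧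
      (∑ j ∈ V, ∑ k ∈ Vᶜ, |A t j k|) ≤ K * (∑ j ∈ V, ∑ k ∈ Vᶜ, |A t k j|)

/-- The protocol establishes modulus consensus: the moduli of all opinions converge
to a common limit for every solution. -/
def ModulusConsensus {N : ℕ} (A : ℝ → Matrix (Fin N) (Fin N) ℝ) : Prop :=
  ∀ x : ℝ → Fin N → ℝ, IsSolution A x →
    ∃ c : ℝ, 0 ≤ c ∧ ∀ i, Tendsto (fun t => |x t i|) atTop (𝓝 c)

/-- The protocol establishes bipartite consensus: there are `v ≠ 0` and `ρ ∈ {±1}^N` such that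
every solution converges to `ρ (vᵀ x(0))`. -/
def BipartiteConsensus {N : ℕ} (A : ℝ → Matrix (Fin N) (Fin N) ℝ) : Prop :=
  ∃ v ρ : Fin N → ℝ, v ≠ 0 ∧ (∀ i, ρ i = 1 ∨ ρ i = -1) ∧
    ∀ x : ℝ → Fin N → ℝ, IsSolution A x →
      ∀ i, Tendsto (fun t => x t i) atTop (𝓝 (ρ i * ∑ j, v j * x 0 j))

/-- The essential-interaction signed graph `𝒢^±` is structurally balanced: the camp `S` and
its complement contain all essentially-cooperating pairs inside a camp and all
essentially-competing pairs between the camps. -/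
def EssStructBal {N : ℕ} (A : ℝ → Matrix (Fin N) (Fin N) ℝ) : Prop :=
  ∃ S : Set (Fin N),
    (∀ j k, EssPlus A j k → (j ∈ S ↔ k ∈ S)) ∧
    (∀ j k, EssMinus A j k → ¬(j ∈ S ↔ k ∈ S))

lemma abs_sLap_le {N : ℕ} (A : Matrix (Fin N) (Fin N) ℝ) (j k : Fin N) :
    |sLap A j k| ≤ ∑ m, |A j m| := by
  unfold sLap
  split_ifs
  · exact (abs_of_nonneg (sum_nonneg fun m _ => abs_nonneg _)).le
  · rw [abs_neg]
    exact single_le_sum (f := fun m => |A j m|) (fun m _ => abs_nonneg _) (mem_univ k)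

lemma IsAdjacency.exists_abs_sLap_le {N : ℕ} {A : ℝ → Matrix (Fin N) (Fin N) ℝ}
    (hA : IsAdjacency A) (T : ℝ) :
    ∃ K : ℝ, 0 ≤ K ∧ ∀ t ∈ Set.Icc (0 : ℝ) T, ∀ j k, |sLap (A t) j k| ≤ K := by
  obtain ⟨C, hC⟩ := hA.2.1 T
  refine ⟨N * |C|, by positivity, fun t ht j k => (abs_sLap_le (A t) j k).trans ?_⟩
  calc ∑ m, |A t j m| ≤ ∑ _m : Fin N, |C| :=
        sum_le_sum fun m _ => (hC t ht j m).trans (le_abs_self C)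
    _ = N * |C| := by simp

lemma IsAdjacency.measurable_sLap {N : ℕ} {A : ℝ → Matrix (Fin N) (Fin N) ℝ}
    (hA : IsAdjacency A) (j k : Fin N) : Measurable fun t => sLap (A t) j k := by
  unfold sLap
  split_ifs
  · exact Finset.measurable_sum _ fun m _ => (hA.1 j m).abs
  · exact (hA.1 j k).neg

lemma IsAdjacency.intervalIntegrable_sLap {N : ℕ} {A : ℝ → Matrix (Fin N) (Fin N) ℝ}
    (hA : IsAdjacency A) {t : ℝ} (ht : 0 ≤ t) (j k : Fin N) :
    IntervalIntegrable (fun s => sLap (A s) j k) volume 0 t := by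
  obtain ⟨K, -, hK⟩ := hA.exists_abs_sLap_le t
  rw [intervalIntegrable_iff_integrableOn_Icc_of_le ht]
  exact Measure.integrableOn_of_bounded (M := K) measure_Icc_lt_top.ne
    (hA.measurable_sLap j k).aestronglyMeasurable
    ((ae_restrict_mem measurableSet_Icc).mono fun s hs => hK s hs j k)

lemma IsAdjacency.intervalIntegrable_sLap_mulVec {N : ℕ} {A : ℝ → Matrix (Fin N) (Fin N) ℝ}
    (hA : IsAdjacency A) {x : ℝ → Fin N → ℝ} (hx : ContinuousOn x (Set.Ici 0))
    {t : ℝ} (ht : 0 ≤ t) (j : Fin N) :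
    IntervalIntegrable (fun s => -((sLap (A s)).mulVec (x s) j)) volume 0 t := by
  simp only [mulVec, dotProduct]
  refine IntervalIntegrable.neg ?_
  have h := IntervalIntegrable.sum (μ := volume) (a := 0) (b := t) univ
    (f := fun k s => sLap (A s) j k * x s k) fun k _ =>
      (hA.intervalIntegrable_sLap ht j k).mul_continuousOn
        ((continuousOn_pi.1 hx k).mono (by
          rw [Set.uIcc_of_le ht]; exact fun s hs => hs.1))
  rwa [Finset.sum_fn] at h

/-- The solutions of the protocol form a linear space. -/
def solutionSpace {N : ℕ} {A : ℝ → Matrix (Fin N) (Fin N) ℝ} (hA : IsAdjacency A) :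
    Submodule ℝ (ℝ → Fin N → ℝ) where
  carrier := {x | IsSolution A x}
  zero_mem' := ⟨continuousOn_const, fun t _ j => by simp⟩
  add_mem' := by
    rintro x y ⟨hx, hx'⟩ ⟨hy, hy'⟩
    refine ⟨hx.add hy, fun t ht j => ?_⟩
    have h := intervalIntegral.integral_add (hA.intervalIntegrable_sLap_mulVec hx ht j)
      (hA.intervalIntegrable_sLap_mulVec hy ht j)
    simp only [Pi.add_apply, mulVec_add, neg_add]
    rw [h, hx' t ht j, hy' t ht j]
    ring
  smul_mem' := by
    rintro c x ⟨hx, hx'⟩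
    refine ⟨hx.const_smul c, fun t ht j => ?_⟩
    simp only [Pi.smul_apply, mulVec_smul, smul_eq_mul, ← mul_neg]
    rw [intervalIntegral.integral_const_mul, hx' t ht j]
    ring

lemma abs_mulVec_le {N : ℕ} {L : Matrix (Fin N) (Fin N) ℝ} {K : ℝ}
    (hL : ∀ j k, |L j k| ≤ K) (x : Fin N → ℝ) (j : Fin N) :
    |L.mulVec x j| ≤ N * K * ‖x‖ := by
  calc |∑ k, L j k * x k| ≤ ∑ k, |L j k * x k| := abs_sum_le_sum_abs _ _
    _ ≤ ∑ _k : Fin N, K * ‖x‖ := sum_le_sum fun k _ => by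
        rw [abs_mul]
        exact mul_le_mul (hL j k) (norm_le_pi_norm x k) (abs_nonneg _)
          ((abs_nonneg _).trans (hL j k))
    _ = N * K * ‖x‖ := by simp [mul_assoc]

/-- Grönwall's inequality in homogeneous integral form. -/
lemma eq_zero_of_le_mul_integral {u : ℝ → ℝ} (hu : Continuous u) (hu0 : ∀ t, 0 ≤ u t)
    {M T : ℝ} (hM : 0 ≤ M) (h : ∀ t ∈ Set.Icc 0 T, u t ≤ M * ∫ s in (0 : ℝ)..t, u s) :
    ∀ t ∈ Set.Icc 0 T, u t = 0 := by
  set g : ℝ → ℝ := fun t => ∫ s in (0 : ℝ)..t, u s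
  have hg : ∀ t, HasDerivAt g (u t) t := fun t => (hu.integral_hasStrictDerivAt 0 t).hasDerivAt
  have key : ∀ t ∈ Set.Icc 0 T, ‖g t‖ ≤ gronwallBound 0 M 0 (t - 0) :=
    norm_le_gronwallBound_of_norm_deriv_right_le
      (fun t _ => (hg t).continuousAt.continuousWithinAt)
      (fun t _ => (hg t).hasDerivWithinAt) (by simp [g]) fun t ht => by
        rw [Real.norm_of_nonneg (hu0 t), add_zero]
        exact (h t ⟨ht.1, ht.2.le⟩).trans (mul_le_mul_of_nonneg_left (le_abs_self _) hM)
  intro t ht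
  have hgt : g t = 0 := by
    have := key t ht
    rw [gronwallBound_ε0_δ0] at this
    exact norm_le_zero_iff.1 this
  have := h t ht
  change u t ≤ M * g t at this
  rw [hgt, mul_zero] at this
  exact this.antisymm (hu0 t)

lemma IsSolution.eq_zero_of_initial_eq_zero {N : ℕ} {A : ℝ → Matrix (Fin N) (Fin N) ℝ}
    (hA : IsAdjacency A) {x : ℝ → Fin N → ℝ} (hx : IsSolution A x) (h0 : x 0 = 0)
    {T : ℝ} (hT : 0 ≤ T) : x T = 0 := by
  obtain ⟨K, hK0, hK⟩ := hA.exists_abs_sLap_le T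
  have hu : Continuous fun t => ‖x (max t 0)‖ :=
    (hx.1.comp_continuous (continuous_id.max continuous_const) fun t => le_max_right t 0).norm
  have hz := eq_zero_of_le_mul_integral hu (fun _ => norm_nonneg _) (M := N * K) (T := T)
    (by positivity) ?_ T ⟨hT, le_rfl⟩
  · simpa [max_eq_left hT] using hz
  intro t ht
  rw [← intervalIntegral.integral_const_mul, max_eq_left ht.1]
  refine (pi_norm_le_iff_of_nonneg (intervalIntegral.integral_nonneg ht.1 fun s _ => by
    positivity)).2 fun j => ?_
  rw [hx.2 t ht.1 j, h0, Pi.zero_apply, zero_add]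
  refine intervalIntegral.norm_integral_le_of_norm_le ht.1 (ae_of_all _ fun s hs => ?_)
    ((continuous_const.mul hu).intervalIntegrable 0 t)
  rw [norm_neg, max_eq_left hs.1.le]
  exact abs_mulVec_le (hK s ⟨hs.1.le, hs.2.trans ht.2⟩) (x s) j

lemma exists_tendsto_of_tendsto_abs {f : ℝ → ℝ} {a c : ℝ} (hf : ContinuousOn f (Set.Ici a))
    (h : Tendsto (fun t => |f t|) atTop (𝓝 c)) (hc : 0 ≤ c) :
    ∃ l, Tendsto f atTop (𝓝 l) ∧ |l| = c := by
  rcases hc.eq_or_lt with rfl | hc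
  · exact ⟨0, (tendsto_zero_iff_abs_tendsto_zero f).2 h, abs_zero⟩
  obtain ⟨T, hT⟩ := eventually_atTop.1 ((h.eventually (lt_mem_nhds hc)).and
    (eventually_ge_atTop a))
  have hcont : ContinuousOn f (Set.Ici T) := hf.mono fun t ht => (hT t ht).2
  rcases isPreconnected_Ici.eq_or_eq_neg_of_sq_eq hcont hcont.abs
    (fun t _ => by simp) (fun ht => (hT _ ht).1.ne') with heq | heq
  · exact ⟨c, h.congr' ((eventually_ge_atTop T).mono fun t ht => (heq ht).symm),
      abs_of_pos hc⟩
  · exact ⟨-c, h.neg.congr' ((eventually_ge_atTop T).mono fun t ht => (heq ht).symm),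
      by rw [abs_neg, abs_of_pos hc]⟩

lemma LinearMap.eq_or_eq_neg_of_abs_eq {V : Type*} [AddCommGroup V] [Module ℝ V]
    {f g : V →ₗ[ℝ] ℝ} (h : ∀ x, |f x| = |g x|) : f = g ∨ f = -g := by
  by_contra! hne
  obtain ⟨x, hx⟩ := DFunLike.ne_iff.1 hne.1
  obtain ⟨y, hy⟩ := DFunLike.ne_iff.1 hne.2
  have hx' := (abs_eq_abs.1 (h x)).resolve_left hx
  have hy' := (abs_eq_abs.1 (h y)).resolve_right hy
  rw [LinearMap.neg_apply] at hy
  rcases abs_eq_abs.1 (h (x + y)) with hxy | hxy <;> rw [map_add, map_add] at hxy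
  · exact hx (by linarith)
  · exact hy (by linarith)

lemma LinearMap.exists_comp_eq_of_ker_le {K V W U : Type*} [Field K] [AddCommGroup V]
    [Module K V] [AddCommGroup W] [Module K W] [AddCommGroup U] [Module K U]
    (e : V →ₗ[K] W) (f : V →ₗ[K] U) (h : LinearMap.ker e ≤ LinearMap.ker f) :
    ∃ g : W →ₗ[K] U, g ∘ₗ e = f := by
  obtain ⟨s, hs⟩ := e.rangeRestrict.exists_rightInverse_of_surjective e.range_rangeRestrict
  obtain ⟨g, hg⟩ := LinearMap.exists_extend (f ∘ₗ s)
  refine ⟨g, LinearMap.ext fun x => ?_⟩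
  have h1 : g (e x) = f (s (e.rangeRestrict x)) := LinearMap.congr_fun hg (e.rangeRestrict x)
  have h2 : e (s (e.rangeRestrict x)) = e x :=
    congrArg Subtype.val (LinearMap.congr_fun hs (e.rangeRestrict x))
  have h3 : s (e.rangeRestrict x) - x ∈ LinearMap.ker f :=
    h (by rw [LinearMap.mem_ker, map_sub, h2, sub_self])
  rw [LinearMap.mem_ker, map_sub, sub_eq_zero] at h3
  exact h1.trans h3

/-- if the protocol establishes modulus consensus, then there are `v ∈ ℝ^N` and
`ρ ∈ {±1}^N` such that every solution converges to `ρ (vᵀ x(0))`. -/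
theorem stmt0 {N : ℕ} (hN : 2 ≤ N) (A : ℝ → Matrix (Fin N) (Fin N) ℝ)
    (hA : IsAdjacency A) (hmc : ModulusConsensus A) :
    ∃ v ρ : Fin N → ℝ, (∀ i, ρ i = 1 ∨ ρ i = -1) ∧
      ∀ x : ℝ → Fin N → ℝ, IsSolution A x →
        ∀ i, Tendsto (fun t => x t i) atTop (𝓝 (ρ i * ∑ j, v j * x 0 j)) := by
  have hlim : ∀ x : solutionSpace hA, ∃ c : ℝ, ∀ i,
      ∃ l, Tendsto (fun t => x.1 t i) atTop (𝓝 l) ∧ |l| = c := fun x => by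
    obtain ⟨c, hc, h⟩ := hmc x.1 x.2
    exact ⟨c, fun i => exists_tendsto_of_tendsto_abs (continuousOn_pi.1 x.2.1 i) (h i) hc⟩
  choose c l hl hlc using hlim
  let limit (i : Fin N) : solutionSpace hA →ₗ[ℝ] ℝ :=
    { toFun := fun x => l x i
      map_add' := fun x y => tendsto_nhds_unique (hl (x + y) i) ((hl x i).add (hl y i))
      map_smul' := fun r x => tendsto_nhds_unique (hl (r • x) i) ((hl x i).const_mul r) }
  let i₀ : Fin N := ⟨0, by omega⟩
  have hsign : ∀ i, ∃ r : ℝ, (r = 1 ∨ r = -1) ∧ ∀ x, l x i = r * l x i₀ := fun i => by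
    rcases LinearMap.eq_or_eq_neg_of_abs_eq (f := limit i) (g := limit i₀)
      (fun x => (hlc x i).trans (hlc x i₀).symm) with h | h
    · exact ⟨1, Or.inl rfl, fun x => (LinearMap.congr_fun h x).trans (one_mul _).symm⟩
    · exact ⟨-1, Or.inr rfl, fun x => (LinearMap.congr_fun h x).trans (neg_one_mul _).symm⟩
  choose ρ hρ hlρ using hsign
  obtain ⟨g, hg⟩ := LinearMap.exists_comp_eq_of_ker_le
    ((LinearMap.proj 0 : (ℝ → Fin N → ℝ) →ₗ[ℝ] Fin N → ℝ) ∘ₗ (solutionSpace hA).subtype)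
    (limit i₀) fun x hx =>
      tendsto_nhds_unique (hl x i₀) (tendsto_const_nhds.congr'
        ((eventually_ge_atTop 0).mono fun t ht =>
          (congrFun (IsSolution.eq_zero_of_initial_eq_zero hA x.2 hx ht) i₀).symm))
  refine ⟨fun j => g (Pi.single j 1), ρ, hρ, fun x hx i => ?_⟩
  have hv : l ⟨x, hx⟩ i₀ = ∑ j, g (Pi.single j 1) * x 0 j := by
    have h1 : g (x 0) = l ⟨x, hx⟩ i₀ := LinearMap.congr_fun hg ⟨x, hx⟩
    rw [← h1, LinearMap.pi_apply_eq_sum_univ g (x 0)]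
    refine sum_congr rfl fun j _ => ?_
    rw [smul_eq_mul, mul_comm]
    congr 2
    ext k
    simp [Pi.single_apply, eq_comm]
  rw [← hv, ← hlρ]
  exact hl ⟨x, hx⟩ i
end

section
/- Let A ∈ ℝ^{N×N} have zero diagonal and suppose ρ ∈ ℝ^N satisfies L[A]ρ = 0 and max_j |ρ_j| = 1. Define V1 = {j : ρ_j = 1} and V2 = {j : ρ_j = −1} and V* = V1 ∪ V2. Then V* is nonempty, a_{jk}ρ_jρ_k ≥ 0 for all j,k ∈ V* (so V1 and V2 form hostile camps within V*: a_{jk} ≥ 0 if j,k are both in V1 or both in V2, and a_{jk} ≤ 0 if j ∈ V1, k ∈ V2 or vice versa), and a_{jk} = 0 whenever j ∈ V* and k ∉ V*. -/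
open MeasureTheory Filter Matrix Finset Topology

/-- Off a zero diagonal, the signed Laplacian acts by `∑ m, (|A j m| x j - A j m x m)`. -/
theorem sLap_mulVec_apply {N : ℕ} (A : Matrix (Fin N) (Fin N) ℝ) (x : Fin N → ℝ) (j : Fin N)
    (hj : A j j = 0) :
    (sLap A).mulVec x j = ∑ m, (|A j m| * x j - A j m * x m) := by
  have hterm : ∀ m, sLap A j m * x m =
      (if j = m then (∑ l, |A j l|) * x j else 0) - A j m * x m := by
    intro m
    unfold sLap
    split_ifs with h
    · subst h
      rw [hj]
      ring
    · ring
  simp only [Matrix.mulVec, dotProduct, hterm, Finset.sum_sub_distrib, Finset.sum_mul,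
    Finset.sum_ite_eq, Finset.mem_univ, if_true]

/-- In a row where a kernel vector bounded by one attains modulus one, every weight is
aligned with the signs of the vector. -/
theorem abs_eq_mul_mul_of_sLap_mulVec_eq_zero {N : ℕ} {A : Matrix (Fin N) (Fin N) ℝ}
    {x : Fin N → ℝ} {j : Fin N} (hjj : A j j = 0) (hker : (sLap A).mulVec x j = 0)
    (hle : ∀ m, |x m| ≤ 1) (hj : |x j| = 1) (k : Fin N) :
    |A j k| = A j k * x j * x k := by
  have hsq : x j * x j = 1 := by rw [← abs_mul_abs_self, hj, one_mul]
  have hnonneg : ∀ m ∈ Finset.univ, 0 ≤ |A j m| - A j m * x j * x m := by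
    intro m _
    have h : |A j m * x j * x m| ≤ |A j m| := by
      rw [abs_mul, abs_mul, hj, mul_one]
      exact mul_le_of_le_one_right (abs_nonneg _) (hle m)
    linarith [le_abs_self (A j m * x j * x m)]
  have hsum : ∑ m, (|A j m| - A j m * x j * x m) = 0 := by
    calc ∑ m, (|A j m| - A j m * x j * x m)
        = x j * ∑ m, (|A j m| * x j - A j m * x m) := by
          rw [Finset.mul_sum]
          exact Finset.sum_congr rfl fun m _ => by linear_combination (-|A j m|) * hsq
      _ = 0 := by rw [← sLap_mulVec_apply A x j hjj, hker, mul_zero]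
  exact sub_eq_zero.mp ((Finset.sum_eq_zero_iff_of_nonneg hnonneg).mp hsum k (Finset.mem_univ k))

/-- if `L[A]ρ = 0` with `max_j |ρ_j| = 1`, then `V* = {j : ρ_j = ±1}` is nonempty,
`V1 = {ρ_j = 1}` and `V2 = {ρ_j = −1}` form hostile camps within `V*`
(`a_{jk} ρ_j ρ_k ≥ 0` on `V*`), and `a_{jk} = 0` for `j ∈ V*`, `k ∉ V*`. -/
theorem stmt2 {N : ℕ} (hN : 2 ≤ N) (A : Matrix (Fin N) (Fin N) ℝ)
    (hdiag : ∀ j, A j j = 0) (ρ : Fin N → ℝ)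
    (hker : (sLap A).mulVec ρ = 0)
    (hle : ∀ j, |ρ j| ≤ 1) (hone : ∃ j, |ρ j| = 1) :
    (∃ j : Fin N, ρ j = 1 ∨ ρ j = -1) ∧
    (∀ j k : Fin N, (ρ j = 1 ∨ ρ j = -1) → (ρ k = 1 ∨ ρ k = -1) →
      0 ≤ A j k * ρ j * ρ k) ∧
    (∀ j k : Fin N, (ρ j = 1 ∨ ρ j = -1) → (ρ k = 1 ∨ ρ k = -1) →
      (ρ j = ρ k → 0 ≤ A j k) ∧ (ρ j = -ρ k → A j k ≤ 0)) ∧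
    (∀ j k : Fin N, (ρ j = 1 ∨ ρ j = -1) → ¬(ρ k = 1 ∨ ρ k = -1) → A j k = 0) := by
  have habs : ∀ j, (ρ j = 1 ∨ ρ j = -1) ↔ |ρ j| = 1 := fun j => (abs_eq zero_le_one).symm
  simp only [habs]
  have key : ∀ j k, |ρ j| = 1 → |A j k| = A j k * ρ j * ρ k := fun j k hj =>
    abs_eq_mul_mul_of_sLap_mulVec_eq_zero (hdiag j) (congrFun hker j) hle hj k
  have hsq : ∀ k, |ρ k| = 1 → ρ k * ρ k = 1 := fun k hk => by
    rw [← abs_mul_abs_self, hk, one_mul]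
  refine ⟨hone, fun j k hj _ => key j k hj ▸ abs_nonneg _,
    fun j k hj hk => ⟨fun h => ?_, fun h => ?_⟩,
    fun j k hj hk => ?_⟩
  · have hjk := key j k hj
    rw [h, mul_assoc, hsq k hk, mul_one] at hjk
    exact hjk ▸ abs_nonneg _
  · have hjk := key j k hj
    rw [h, mul_assoc, neg_mul, hsq k hk] at hjk
    linarith [abs_nonneg (A j k)]
  · by_contra hne
    have hlt : |A j k * ρ j * ρ k| < |A j k| := by
      rw [abs_mul, abs_mul, hj, mul_one]
      exact mul_lt_of_lt_one_right (abs_pos.mpr hne) (lt_of_le_of_ne (hle k) hk)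
    rw [← key j k hj, abs_abs] at hlt
    exact lt_irrefl _ hlt
end

section
/- Let f_1, …, f_N : [0,∞) → ℝ be locally Lipschitz functions. Then there exist measurable functions k^1, …, k^N : [0,∞) → {1,…,N} such that for every t the tuple (k^1(t),…,k^N(t)) is a permutation of {1,…,N} sorting the values in ascending order, f_{k^1(t)}(t) ≤ f_{k^2(t)}(t) ≤ … ≤ f_{k^N(t)}(t), the functions F_j(t) := f_{k^j(t)}(t) are locally Lipschitz, and for every j and almost every t ≥ 0 the derivative identity Ḟ_j(t) = ḟ_{k^j(t)}(t) holds. -/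
open MeasureTheory Filter Matrix Finset Topology

/-- If `g ≤ h + c` entrywise, then the same inequality holds between the sorted tuples. -/
theorem Tuple.apply_sort_le_apply_sort_add {n : ℕ} {g h : Fin n → ℝ} {c : ℝ}
    (hgh : ∀ i, g i ≤ h i + c) (j : Fin n) :
    g (Tuple.sort g j) ≤ h (Tuple.sort h j) + c := by
  have card_sort (u : Fin n → ℝ) (a : ℝ) :
      #{i | (u ∘ Tuple.sort u) i ≤ a} = #{i | u i ≤ a} :=
    Finset.card_equiv (Tuple.sort u) (by simp)
  refine (Tuple.lt_card_le_iff_apply_le_of_monotone (Tuple.monotone_sort g)).1 ?_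
  have hj := (Tuple.lt_card_le_iff_apply_le_of_monotone
    (j := j) (a := h (Tuple.sort h j)) (Tuple.monotone_sort h)).2 le_rfl
  rw [card_sort] at hj ⊢
  refine hj.trans_le (Finset.card_le_card fun i hi => ?_)
  simp only [Finset.mem_filter, Finset.mem_univ, true_and] at hi ⊢
  linarith [hgh i]

/-- The index of the `j`-th smallest value of a tuple of measurable functions is a measurable
function of the point. -/
theorem Tuple.measurable_sort_apply {α : Type*} [MeasurableSpace α] {n : ℕ} {u : Fin n → α → ℝ}
    (hu : ∀ i, Measurable (u i)) (j : Fin n) :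
    Measurable fun x => Tuple.sort (fun i => u i x) j := by
  let _ : MeasurableSpace (Equiv.Perm (Fin n)) := ⊤
  have hsort : Measurable fun x => Tuple.sort fun i => u i x := by
    refine measurable_to_countable' fun p => ?_
    have hp : (fun x => Tuple.sort fun i => u i x) ⁻¹' {p} =
        {x | (∀ i j, i ≤ j → u (p i) x ≤ u (p j) x) ∧
          ∀ i j, i < j → u (p i) x = u (p j) x → p i < p j} := by
      ext x
      exact eq_comm.trans Tuple.eq_sort_iff
    rw [hp]
    refine MeasurableSet.inter (s₁ := {x | ∀ i j, i ≤ j → u (p i) x ≤ u (p j) x})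
      (s₂ := {x | ∀ i j, i < j → u (p i) x = u (p j) x → p i < p j}) ?_ ?_
    · simp only [Set.ofPred_forall]
      exact .iInter fun i => .iInter fun j => .iInter fun _ => measurableSet_le (hu _) (hu _)
    · simp only [Set.ofPred_forall]
      exact .iInter fun i => .iInter fun j => .iInter fun _ =>
        (measurableSet_eq_fun (hu _) (hu _)).imp (.const _)
  exact (measurable_from_top (f := fun p : Equiv.Perm (Fin n) => p j)).comp hsort

/-- The zeros of a real function at which its derivative exists and is nonzero form a
countable set. -/
theorem countable_setOf_eq_zero_hasDerivAt_ne_zero (h : ℝ → ℝ) :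
    {x | h x = 0 ∧ ∃ d, d ≠ 0 ∧ HasDerivAt h d x}.Countable := by
  refine (HereditarilyLindelofSpace.isLindelof _).countable_of_isDiscrete
    (isDiscrete_iff_nhdsNE.2 ?_)
  rintro x ⟨-, d, hd, hx⟩
  rw [← disjoint_iff, Filter.disjoint_principal_right]
  filter_upwards [hx.eventually_ne (c := 0) hd] with y hy hmem using hy hmem.1

/-- At almost every point where two real functions agree and are both differentiable, their
derivatives agree. -/
theorem ae_hasDerivAt_eq_of_eq (g h : ℝ → ℝ) :
    ∀ᵐ x, ∀ d e : ℝ, g x = h x → HasDerivAt g d x → HasDerivAt h e x → d = e := by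
  filter_upwards [(countable_setOf_eq_zero_hasDerivAt_ne_zero (g - h)).ae_notMem volume]
    with x hx d e hgh hg hh
  by_contra hne
  exact hx ⟨sub_eq_zero.2 hgh, d - e, sub_ne_zero.2 hne, hg.sub hh⟩

/-- A locally Lipschitz function on `[0,∞)` is differentiable almost everywhere. -/
theorem ae_differentiableAt_of_lipschitzOnWith_Icc {g : ℝ → ℝ}
    (hg : ∀ a b : ℝ, 0 ≤ a → ∃ L : NNReal, LipschitzOnWith L g (Set.Icc a b)) :
    ∀ᵐ t ∂(volume.restrict (Set.Ici (0:ℝ))), DifferentiableAt ℝ g t := by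
  rw [ae_restrict_iff' measurableSet_Ici]
  have hdiff (n : ℕ) :
      ∀ᵐ t : ℝ, t ∈ Set.Icc (0:ℝ) n → DifferentiableWithinAt ℝ g (Set.Icc 0 n) t :=
    (hg 0 n le_rfl).choose_spec.ae_differentiableWithinAt_of_mem
  filter_upwards [ae_all_iff.2 hdiff, (Set.countable_singleton (0:ℝ)).ae_notMem volume]
    with t ht ht0 htnonneg
  obtain ⟨n, hn⟩ := exists_nat_gt t
  have hpos : 0 < t := lt_of_le_of_ne htnonneg (Ne.symm ht0)
  exact (ht n ⟨hpos.le, hn.le⟩).differentiableAt (Icc_mem_nhds hpos hn)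

/-- measurable ordering permutations exist for a finite family of locally
Lipschitz functions, the sorted functions are locally Lipschitz, and a.e. the derivative of the
`j`-th sorted function equals the derivative of the selected function. -/
theorem stmt6 {N : ℕ} (f : Fin N → ℝ → ℝ)
    (hf : ∀ i, ∀ a b : ℝ, 0 ≤ a → ∃ L : NNReal, LipschitzOnWith L (f i) (Set.Icc a b)) :
    ∃ σ : ℝ → Fin N → Fin N,
      (∀ t, Function.Bijective (σ t)) ∧
      (∀ j, Measurable fun t => σ t j) ∧
      (∀ t ∈ Set.Ici (0:ℝ), ∀ j j' : Fin N, j ≤ j' → f (σ t j) t ≤ f (σ t j') t) ∧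
      (∀ j : Fin N, ∀ a b : ℝ, 0 ≤ a →
        ∃ L : NNReal, LipschitzOnWith L (fun t => f (σ t j) t) (Set.Icc a b)) ∧
      (∀ᵐ t ∂(volume.restrict (Set.Ici (0:ℝ))), ∀ j : Fin N, ∃ d : ℝ,
        HasDerivAt (f (σ t j)) d t ∧ HasDerivAt (fun s => f (σ s j) s) d t) := by
  have hmono (t : ℝ) := Tuple.monotone_sort fun i => f i (max t 0)
  have hlip (j : Fin N) (a b : ℝ) (ha : 0 ≤ a) : ∃ L : NNReal, LipschitzOnWith L
      (fun t => f (Tuple.sort (fun i => f i (max t 0)) j) t) (Set.Icc a b) := by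
    choose L hL using fun i => hf i a b ha
    refine ⟨∑ i, L i, .of_le_add_mul _ fun s hs t ht => ?_⟩
    have hs0 : max s 0 = s := max_eq_left (ha.trans hs.1)
    have ht0 : max t 0 = t := max_eq_left (ha.trans ht.1)
    rw [hs0, ht0]
    refine Tuple.apply_sort_le_apply_sort_add (g := fun i => f i s) (h := fun i => f i t)
      (fun i => ?_) j
    have hi : f i s ≤ f i t + L i * dist s t := (hL i).le_add_mul hs ht
    have hLi : (L i : ℝ) ≤ (∑ k, L k : NNReal) := by
      exact_mod_cast Finset.single_le_sum (fun k _ => zero_le) (Finset.mem_univ i)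
    exact hi.trans (by gcongr)
  refine ⟨fun t => Tuple.sort fun i => f i (max t 0), fun t => Equiv.bijective _, fun j => ?_,
    fun t ht j j' hjj' => ?_, hlip, ?_⟩
  · refine Tuple.measurable_sort_apply (u := fun i t => f i (max t 0)) (fun i => ?_) j
    refine Continuous.measurable (continuous_iff_continuousAt.2 fun t => ?_)
    obtain ⟨L, hL⟩ := hf i 0 (max t 0 + 1) le_rfl
    have hcont : ContinuousOn (fun s => f i (max s 0)) (Set.Iic (max t 0 + 1)) :=
      hL.continuousOn.comp (by fun_prop) fun s hs =>
        ⟨le_max_right _ _, max_le hs (by positivity)⟩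
    exact hcont.continuousAt (Iic_mem_nhds (by linarith [le_max_left t 0]))
  · simpa [max_eq_left (Set.mem_Ici.1 ht)] using hmono t hjj'
  · have hdf := ae_all_iff.2 fun i => ae_differentiableAt_of_lipschitzOnWith_Icc (hf i)
    have hdF := ae_all_iff.2 fun j => ae_differentiableAt_of_lipschitzOnWith_Icc (hlip j)
    have heq := ae_all_iff.2 fun i => ae_all_iff.2 fun j =>
      ae_restrict_of_ae (s := Set.Ici (0:ℝ)) (ae_hasDerivAt_eq_of_eq (f i)
        fun t => f (Tuple.sort (fun i => f i (max t 0)) j) t)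
    filter_upwards [hdf, hdF, heq] with t hft hFt ht j
    refine ⟨_, (hft _).hasDerivAt, ?_⟩
    rw [ht _ j _ _ rfl (hft _).hasDerivAt (hFt j).hasDerivAt]
    exact (hFt j).hasDerivAt
end

section
/- Suppose |A(t)|_∞ := max_j Σ_k |a_{jk}(t)| ≤ R for almost all t ∈ [t₀,t₁] and set θ₀ = e^{−R(t₁−t₀)}. Then any solution of the protocol ẋ(t) = −L[A(t)]x(t) satisfies |x_k(t)| ≤ θ₀|x_k(t₀)| + (1 − θ₀)|x(t₀)|_∞ for every k ∈ {1,…,N} and every t ∈ [t₀,t₁]. -/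
open MeasureTheory Filter Matrix Finset Topology

/-- A one-sided Grönwall estimate for absolutely continuous functions. -/
theorem AbsolutelyContinuousOnInterval.sub_le_exp_mul_sub {y : ℝ → ℝ} {a b R S : ℝ} (hab : a ≤ b)
    (hy : AbsolutelyContinuousOnInterval y a b)
    (h : ∀ᵐ s, s ∈ Set.Icc a b → deriv y s ≤ R * (S - y s)) :
    y b - S ≤ Real.exp (-R * (b - a)) * (y a - S) := by
  have hE : AbsolutelyContinuousOnInterval (fun s => Real.exp (R * s)) a b :=
    ContDiffOn.absolutelyContinuousOnInterval (by fun_prop)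
  have hS : AbsolutelyContinuousOnInterval (fun s => y s - S) a b :=
    hy.fun_sub (ContDiffOn.absolutelyContinuousOnInterval contDiffOn_const)
  have hF := hE.fun_mul hS
  have hint : ∫ s in a..b, deriv (fun s => Real.exp (R * s) * (y s - S)) s ≤ 0 := by
    rw [intervalIntegral.integral_of_le hab]
    refine integral_nonpos_of_ae ?_
    refine (ae_restrict_iff' measurableSet_Ioc).2 ?_
    filter_upwards [h, hy.ae_differentiableAt] with s hs hd hmem
    have hmem' := Set.Ioc_subset_Icc_self hmem
    have hd' := (hd (by rwa [Set.uIcc_of_le hab])).hasDerivAt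
    have he : HasDerivAt (fun s => Real.exp (R * s)) (Real.exp (R * s) * R) s := by
      simpa using ((hasDerivAt_id s).const_mul R).exp
    rw [(he.fun_mul (hd'.sub_const S)).deriv]
    have := mul_le_mul_of_nonneg_left (hs hmem') (Real.exp_pos (R * s)).le
    simp only [Pi.zero_apply]
    linarith
  rw [hF.integral_deriv_eq_sub] at hint
  have hsplit : Real.exp (-R * (b - a)) = Real.exp (-(R * b)) * Real.exp (R * a) := by
    rw [← Real.exp_add]; ring_nf
  have hinv : Real.exp (-(R * b)) * Real.exp (R * b) = 1 := by
    rw [← Real.exp_add]; simp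
  have hmul := mul_le_mul_of_nonneg_left (sub_nonpos.1 hint) (Real.exp_pos (-(R * b))).le
  rw [← mul_assoc, ← mul_assoc, hinv, one_mul] at hmul
  rwa [hsplit]

theorem sLap_mulVec {N : ℕ} {A : Matrix (Fin N) (Fin N) ℝ} (hA : ∀ j, A j j = 0)
    (v : Fin N → ℝ) (j : Fin N) :
    (sLap A).mulVec v j = (∑ m, |A j m|) * v j - ∑ m, A j m * v m := by
  have h : ∀ m, sLap A j m * v m =
      (if j = m then (∑ l, |A j l|) * v m else 0) - A j m * v m := by
    intro m
    by_cases hjm : j = m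
    · subst hjm
      simp [sLap, hA]
    · simp [sLap, hjm]
  simp only [Matrix.mulVec, dotProduct, h, Finset.sum_sub_distrib]
  simp

theorem neg_sLap_mulVec_le {N : ℕ} {A : Matrix (Fin N) (Fin N) ℝ} (hA : ∀ j, A j j = 0)
    {v : Fin N → ℝ} {R S : ℝ} {j : Fin N} (hR : ∑ m, |A j m| ≤ R) (hv : ‖v‖ ≤ S) :
    -((sLap A).mulVec v j) ≤ R * (S - v j) := by
  have hvm : ∀ m, |v m| ≤ S := fun m => (norm_le_pi_norm v m).trans hv
  have hsum : ∑ m, A j m * v m ≤ (∑ m, |A j m|) * S := by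
    rw [Finset.sum_mul]
    refine Finset.sum_le_sum fun m _ => (le_abs_self _).trans ?_
    rw [abs_mul]
    exact mul_le_mul_of_nonneg_left (hvm m) (abs_nonneg _)
  have hj : 0 ≤ S - v j := sub_nonneg.2 ((le_abs_self _).trans (hvm j))
  rw [sLap_mulVec hA]
  linarith [mul_le_mul_of_nonneg_right hR hj]

theorem IsAdjacency.intervalIntegrable_mulVec {N : ℕ} {A : ℝ → Matrix (Fin N) (Fin N) ℝ}
    (hA : IsAdjacency A) {x : ℝ → Fin N → ℝ} (hx : ContinuousOn x (Set.Ici 0)) {T : ℝ}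
    (hT : 0 ≤ T) (j : Fin N) :
    IntervalIntegrable (fun s => -((sLap (A s)).mulVec (x s) j)) volume 0 T := by
  obtain ⟨C, hC⟩ := hA.2.1 T
  have hent : ∀ k, IntervalIntegrable (fun s => A s j k) volume 0 T := by
    intro k
    rw [intervalIntegrable_iff_integrableOn_Ioc_of_le hT]
    refine Measure.integrableOn_of_bounded (M := C) (by simp)
      (hA.1 j k).aestronglyMeasurable ?_
    refine (ae_restrict_iff' measurableSet_Ioc).2 (ae_of_all _ fun s hs => ?_)
    exact hC s (Set.Ioc_subset_Icc_self hs) j k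
  have hxc : ∀ k, ContinuousOn (fun s => x s k) (Set.uIcc 0 T) := fun k =>
    ((continuous_apply k).comp_continuousOn hx).mono
      (by rw [Set.uIcc_of_le hT]; exact Set.Icc_subset_Ici_self)
  simp only [fun s => sLap_mulVec (hA.2.2 s) (x s) j]
  have habs : IntervalIntegrable (fun s => ∑ m, |A s j m|) volume 0 T := by
    simpa only [Finset.sum_fn] using
      IntervalIntegrable.sum (Finset.univ : Finset (Fin N)) fun m _ => (hent m).abs
  have hsum : IntervalIntegrable (fun s => ∑ m, A s j m * x s m) volume 0 T := by
    simpa only [Finset.sum_fn] using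
      IntervalIntegrable.sum (Finset.univ : Finset (Fin N))
        fun m _ => (hent m).mul_continuousOn (hxc m)
  exact ((habs.mul_continuousOn (hxc j)).sub hsum).neg

theorem IsSolution.neg {N : ℕ} {A : ℝ → Matrix (Fin N) (Fin N) ℝ} {x : ℝ → Fin N → ℝ}
    (hx : IsSolution A x) : IsSolution A (fun t => -x t) := by
  refine ⟨hx.1.neg, fun t ht j => ?_⟩
  simp only [Matrix.mulVec_neg, Pi.neg_apply]
  rw [hx.2 t ht j, intervalIntegral.integral_neg, intervalIntegral.integral_neg,
    intervalIntegral.integral_neg]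
  ring

theorem IsSolution.sub_le_exp_mul_sub {N : ℕ} {A : ℝ → Matrix (Fin N) (Fin N) ℝ}
    (hA : IsAdjacency A) {x : ℝ → Fin N → ℝ} (hx : IsSolution A x) {a b R S : ℝ} (ha : 0 ≤ a)
    (hab : a ≤ b) (hR : ∀ᵐ t, t ∈ Set.Icc a b → ∀ j, ∑ k, |A t j k| ≤ R)
    (hS : ∀ t ∈ Set.Icc a b, ‖x t‖ ≤ S) (k : Fin N) :
    x b k - S ≤ Real.exp (-R * (b - a)) * (x a k - S) := by
  have hb := ha.trans hab
  have hint := hA.intervalIntegrable_mulVec hx.1 hb k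
  set g : ℝ → ℝ := fun s => -((sLap (A s)).mulVec (x s) k) with hg
  have hsub : Set.Icc a b ⊆ Set.Icc 0 b := Set.Icc_subset_Icc_left ha
  have hac : AbsolutelyContinuousOnInterval (fun t => x 0 k + ∫ s in (0:ℝ)..t, g s) a b := by
    refine AbsolutelyContinuousOnInterval.mono (a := 0) (b := b) ?_ ?_
    · exact (ContDiffOn.absolutelyContinuousOnInterval contDiffOn_const).fun_add
        (hint.absolutelyContinuousOnInterval_intervalIntegral (by simp))
    · rwa [Set.uIcc_of_le hab, Set.uIcc_of_le hb]
  have key := hac.sub_le_exp_mul_sub (R := R) (S := S) hab ?_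
  · simpa only [hg, ← hx.2 b hb k, ← hx.2 a ha k] using key
  filter_upwards [hR, hint.ae_hasDerivAt_integral] with s hs hd hmem
  have hd' := hd (by rw [Set.uIcc_of_le hb]; exact hsub hmem) 0 (by simp)
  rw [(hd'.const_add (x 0 k)).deriv, ← hx.2 s (hsub hmem).1 k]
  exact neg_sLap_mulVec_le (hA.2.2 s) (hs hmem k) (hS s hmem)

theorem IsSolution.abs_le_of_norm_le {N : ℕ} {A : ℝ → Matrix (Fin N) (Fin N) ℝ}
    (hA : IsAdjacency A) {x : ℝ → Fin N → ℝ} (hx : IsSolution A x) {a b R S : ℝ} (ha : 0 ≤ a)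
    (hab : a ≤ b) (hR : ∀ᵐ t, t ∈ Set.Icc a b → ∀ j, ∑ k, |A t j k| ≤ R)
    (hS : ∀ t ∈ Set.Icc a b, ‖x t‖ ≤ S) (k : Fin N) :
    |x b k| ≤ Real.exp (-R * (b - a)) * |x a k| + (1 - Real.exp (-R * (b - a))) * S := by
  have h1 := hx.sub_le_exp_mul_sub hA ha hab hR hS k
  have h2 := hx.neg.sub_le_exp_mul_sub hA ha hab hR (by simpa only [norm_neg] using hS) k
  simp only [Pi.neg_apply] at h2
  have he := (Real.exp_pos (-R * (b - a))).le
  have h3 := mul_le_mul_of_nonneg_left (le_abs_self (x a k)) he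
  have h4 := mul_le_mul_of_nonneg_left (neg_le_abs (x a k)) he
  exact abs_le'.2 ⟨by linarith, by linarith⟩

theorem IsSolution.norm_le_norm_left {N : ℕ} {A : ℝ → Matrix (Fin N) (Fin N) ℝ}
    (hA : IsAdjacency A) {x : ℝ → Fin N → ℝ} (hx : IsSolution A x) {a b R : ℝ} (ha : 0 ≤ a)
    (hab : a ≤ b) (hR : ∀ᵐ t, t ∈ Set.Icc a b → ∀ j, ∑ k, |A t j k| ≤ R) (hR0 : 0 ≤ R) :
    ∀ t ∈ Set.Icc a b, ‖x t‖ ≤ ‖x a‖ := by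
  obtain ⟨τ, hτ, hmax⟩ := isCompact_Icc.exists_isMaxOn (Set.nonempty_Icc.2 hab)
    ((hx.1.mono fun t ht => ha.trans ht.1).norm : ContinuousOn (fun t => ‖x t‖) (Set.Icc a b))
  suffices h : ‖x τ‖ ≤ ‖x a‖ from fun t ht => (hmax ht).trans h
  have hsub : Set.Icc a τ ⊆ Set.Icc a b := Set.Icc_subset_Icc_right hτ.2
  have he := Real.exp_pos (-R * (τ - a))
  have he1 : Real.exp (-R * (τ - a)) ≤ 1 :=
    Real.exp_le_one_iff.2 (by nlinarith [hτ.1])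
  have hk : ∀ k, |x τ k| ≤ Real.exp (-R * (τ - a)) * ‖x a‖
      + (1 - Real.exp (-R * (τ - a))) * ‖x τ‖ := fun k =>
    (hx.abs_le_of_norm_le hA ha hτ.1 (hR.mono fun t h ht => h (hsub ht))
      (fun t ht => hmax (hsub ht)) k).trans
      (by gcongr; exact norm_le_pi_norm (x a) k)
  have hle : ‖x τ‖ ≤ Real.exp (-R * (τ - a)) * ‖x a‖
      + (1 - Real.exp (-R * (τ - a))) * ‖x τ‖ := (pi_norm_le_iff_of_nonneg (add_nonneg (mul_nonneg he.le (norm_nonneg _))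
    (mul_nonneg (sub_nonneg.2 he1) (norm_nonneg _)))).2 hk
  exact le_of_mul_le_mul_left (by linarith) he

/-- if `|A(t)|_∞ ≤ R` a.e. on `[t₀,t₁]` and `θ₀ = e^{−R(t₁−t₀)}`, then
`|x_k(t)| ≤ θ₀ |x_k(t₀)| + (1 − θ₀) |x(t₀)|_∞` for all `k` and `t ∈ [t₀,t₁]`. -/
theorem stmt8 {N : ℕ} (hN : 2 ≤ N) (A : ℝ → Matrix (Fin N) (Fin N) ℝ)
    (hA : IsAdjacency A) (x : ℝ → Fin N → ℝ) (hx : IsSolution A x)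
    (t0 t1 R : ℝ) (h0 : 0 ≤ t0) (h01 : t0 ≤ t1)
    (hR : ∀ᵐ t ∂(volume.restrict (Set.Icc t0 t1)), ∀ j, ∑ k, |A t j k| ≤ R) :
    ∀ k : Fin N, ∀ t ∈ Set.Icc t0 t1,
      |x t k| ≤ Real.exp (-R * (t1 - t0)) * |x t0 k|
        + (1 - Real.exp (-R * (t1 - t0))) * ‖x t0‖ := by
  intro k t ht
  have hnorm : |x t0 k| ≤ ‖x t0‖ := norm_le_pi_norm (x t0) k
  rcases h01.eq_or_lt with rfl | hlt
  · obtain rfl : t = t0 := le_antisymm ht.2 ht.1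
    simp
  have hR0 : 0 ≤ R := by
    have : NeZero (volume.restrict (Set.Icc t0 t1)) :=
      ⟨by simpa [Measure.restrict_eq_zero] using hlt⟩
    obtain ⟨s, hs⟩ := hR.exists
    exact (Finset.sum_nonneg fun m _ => abs_nonneg (A s k m)).trans (hs k)
  have hR' := (ae_restrict_iff' measurableSet_Icc).1 hR
  have hle := hx.norm_le_norm_left hA h0 h01 hR' hR0
  have hsub : Set.Icc t0 t ⊆ Set.Icc t0 t1 := Set.Icc_subset_Icc_right ht.2
  have hb := hx.abs_le_of_norm_le hA h0 ht.1 (hR'.mono fun s h hs => h (hsub hs))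
    (fun s hs => hle s (hsub hs)) k
  have hexp : Real.exp (-R * (t1 - t0)) ≤ Real.exp (-R * (t - t0)) :=
    Real.exp_le_exp.2 (by nlinarith [ht.2])
  linarith [mul_le_mul_of_nonneg_right hexp (sub_nonneg.2 hnorm)]
end

section
/- Suppose the entries a_{jk}(t) are bounded on [0,∞) and the time-varying graph G[A(·)] is uniformly strongly connected (USC). Then the protocol ẋ(t) = −L[A(t)]x(t) establishes modulus consensus: for every solution x there exists x* ≥ 0 such that lim_{t→∞}|x_i(t)| = x* for every i ∈ {1,…,N}. -/
open MeasureTheory Filter Matrix Finset Topology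

/-- Integrating-factor formula: if `y` is a primitive of `h` on `[s, t]`, then `e^{cr} y(r)` is a
primitive of `e^{cr} (c y(r) + h(r))`. -/
lemma exp_mul_sub_exp_mul_eq_integral {y h : ℝ → ℝ} {s t : ℝ} (c : ℝ) (hst : s ≤ t)
    (hh : IntervalIntegrable h volume s t)
    (hy : ∀ r ∈ Set.Icc s t, y r = y s + ∫ u in s..r, h u) :
    Real.exp (c * t) * y t - Real.exp (c * s) * y s
      = ∫ r in s..t, Real.exp (c * r) * (c * y r + h r) := by
  have hexp : ∀ r : ℝ, HasDerivAt (fun r => Real.exp (c * r)) (Real.exp (c * r) * c) r := by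
    intro r
    simpa using ((hasDerivAt_id r).const_mul c).exp
  have hf : AbsolutelyContinuousOnInterval (fun r => Real.exp (c * r)) s t := by
    apply ContDiffOn.absolutelyContinuousOnInterval
    fun_prop
  have hg : AbsolutelyContinuousOnInterval (fun r => y s + ∫ u in s..r, h u) s t :=
    (LipschitzOnWith.absolutelyContinuousOnInterval (K := 0)
      (LipschitzWith.const (y s)).lipschitzOnWith).add
      (hh.absolutelyContinuousOnInterval_intervalIntegral (c := s) (by simp))
  have key := hf.integral_deriv_mul_eq_sub hg
  rw [← hy t ⟨hst, le_rfl⟩, ← hy s ⟨le_rfl, hst⟩] at key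
  rw [← key]
  apply intervalIntegral.integral_congr_ae
  filter_upwards [hh.ae_hasDerivAt_integral] with r hr hmem
  have hmem' : r ∈ Set.uIcc s t := Set.uIoc_subset_uIcc hmem
  have hd := (hr hmem' s (by simp)).const_add (y s)
  rw [(hexp r).deriv, hd.deriv, ← hy r (by rwa [Set.uIcc_of_le hst] at hmem')]
  ring

/-- Grönwall's inequality in integral form. -/
lemma le_mul_exp_of_le_add_integral {q : ℝ → ℝ} {a c s t : ℝ} (hq : Continuous q) (hc : 0 ≤ c)
    (hst : s ≤ t) (h : ∀ r ∈ Set.Icc s t, q r ≤ a + c * ∫ u in s..r, q u) :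
    q t ≤ a * Real.exp (c * (t - s)) := by
  have hd : ∀ r, HasDerivAt (fun r => a + c * ∫ u in s..r, q u) (c * q r) r := fun r =>
    ((intervalIntegral.integral_hasDerivAt_right (hq.intervalIntegrable _ _)
      (hq.stronglyMeasurableAtFilter _ _) hq.continuousAt).const_mul c).const_add a
  have hG := le_gronwallBound_of_liminf_deriv_right_le (f := fun r => a + c * ∫ u in s..r, q u)
    (f' := fun r => c * q r) (δ := a) (K := c) (ε := 0) (a := s) (b := t)
    (fun r _ => (hd r).continuousAt.continuousWithinAt)
    (fun r _ b hb => (hd r).hasDerivWithinAt.liminf_right_slope_le hb)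
    (by simp)
    (fun r hr => by
      have := mul_le_mul_of_nonneg_left (h r ⟨hr.1, hr.2.le⟩) hc
      simpa using this) t ⟨hst, le_rfl⟩
  rw [gronwallBound_ε0] at hG
  exact (h t ⟨hst, le_rfl⟩).trans hG

section Protocol

variable {N : ℕ} {A : ℝ → Matrix (Fin N) (Fin N) ℝ} {x : ℝ → Fin N → ℝ}

/-- The right-hand side of the protocol, for an adjacency matrix with zero diagonal. -/
lemma neg_sLap_mulVec (B : Matrix (Fin N) (Fin N) ℝ) (hB : ∀ j, B j j = 0) (v : Fin N → ℝ)
    (i : Fin N) :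
    -((sLap B).mulVec v i) = ∑ k, B i k * v k - (∑ k, |B i k|) * v i := by
  have : ∀ k, sLap B i k * v k = (if i = k then (∑ m, |B i m|) * v i else 0) - B i k * v k := by
    intro k
    unfold sLap
    split_ifs with h
    · subst h; simp [hB]
    · ring
  simp only [Matrix.mulVec, dotProduct, this, Finset.sum_sub_distrib]
  simp

lemma IsSolution.continuousOn_apply (hx : IsSolution A x) (i : Fin N) :
    ContinuousOn (fun r => x r i) (Set.Ici 0) :=
  (continuous_apply i).comp_continuousOn hx.1

lemma IsAdjacency.intervalIntegrable (hA : IsAdjacency A) {s t : ℝ} (hs : 0 ≤ s) (hst : s ≤ t)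
    (i k : Fin N) : IntervalIntegrable (fun r => A r i k) volume s t := by
  obtain ⟨C, hC⟩ := hA.2.1 t
  refine (intervalIntegrable_const (c := C)).mono_fun (hA.1 i k).aestronglyMeasurable ?_
  refine (ae_restrict_iff' measurableSet_uIoc).2 (ae_of_all _ fun r hr => ?_)
  rw [Set.uIoc_of_le hst] at hr
  exact (hC r ⟨hs.trans hr.1.le, hr.2⟩ i k).trans (le_abs_self C)

lemma IsSolution.intervalIntegrable_drift (hA : IsAdjacency A) (hx : IsSolution A x) {s t : ℝ}
    (hs : 0 ≤ s) (hst : s ≤ t) (i : Fin N) :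
    IntervalIntegrable (fun r => ∑ k, A r i k * x r k - (∑ k, |A r i k|) * x r i)
      volume s t := by
  have hc : ∀ k, ContinuousOn (fun r => x r k) (Set.uIcc s t) := fun k =>
    (hx.continuousOn_apply k).mono fun r hr => by
      rw [Set.uIcc_of_le hst] at hr; exact hs.trans hr.1
  have h1 : IntervalIntegrable (fun r => ∑ k, A r i k * x r k) volume s t := by
    have := IntervalIntegrable.sum (μ := volume) (a := s) (b := t) Finset.univ
      (f := fun k r => A r i k * x r k)
      (fun k _ => (hA.intervalIntegrable hs hst i k).mul_continuousOn (hc k))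
    simpa [Finset.sum_fn] using this
  have h2 : IntervalIntegrable (fun r => ∑ k, |A r i k|) volume s t := by
    have := IntervalIntegrable.sum (μ := volume) (a := s) (b := t) Finset.univ
      (f := fun k r => |A r i k|)
      (fun k _ => (hA.intervalIntegrable hs hst i k).abs)
    simpa [Finset.sum_fn] using this
  exact h1.sub (h2.mul_continuousOn (hc i))

lemma IsSolution.eq_add_integral (hA : IsAdjacency A) (hx : IsSolution A x) {s t : ℝ}
    (hs : 0 ≤ s) (hst : s ≤ t) (i : Fin N) :
    x t i = x s i + ∫ r in s..t, (∑ k, A r i k * x r k - (∑ k, |A r i k|) * x r i) := by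
  have h1 := hx.2 t (hs.trans hst) i
  have h2 := hx.2 s hs i
  simp only [fun r => neg_sLap_mulVec (A r) (hA.2.2 r) (x r) i] at h1 h2
  rw [h1, h2, add_assoc, intervalIntegral.integral_add_adjacent_intervals]
  · exact hx.intervalIntegrable_drift hA le_rfl hs i
  · exact hx.intervalIntegrable_drift hA hs hst i

/-- The largest modulus of the opinions does not increase. -/
lemma IsSolution.norm_le_norm (hA : IsAdjacency A) (hx : IsSolution A x) {c : ℝ}
    (hc : 0 ≤ c) (hAc : ∀ r ≥ 0, ∀ i, ∑ k, |A r i k| ≤ c) {s t : ℝ}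
    (hs : 0 ≤ s) (hst : s ≤ t) : ‖x t‖ ≤ ‖x s‖ := by
  have hcont : Continuous fun r => Real.exp (c * r) * ‖x (max r 0)‖ := by
    have : Continuous fun r => x (max r 0) :=
      hx.1.comp_continuous (by fun_prop) fun r => Set.mem_Ici.2 (le_max_right _ _)
    exact (by fun_prop : Continuous fun r => Real.exp (c * r)).mul this.norm
  have hG := le_mul_exp_of_le_add_integral (a := Real.exp (c * s) * ‖x s‖) hcont hc hst ?_
  · rw [max_eq_left (hs.trans hst), mul_right_comm, ← Real.exp_add,
      show c * s + c * (t - s) = c * t by ring] at hG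
    exact le_of_mul_le_mul_left hG (Real.exp_pos _)
  intro r hr
  have hr0 : 0 ≤ r := hs.trans hr.1
  rw [max_eq_left hr0]
  set I := ∫ u in s..r, Real.exp (c * u) * ‖x (max u 0)‖ with hI
  have hI0 : 0 ≤ I := intervalIntegral.integral_nonneg hr.1 fun u _ => by positivity
  suffices ‖x r‖ ≤ Real.exp (-(c * r)) * (Real.exp (c * s) * ‖x s‖ + c * I) by
    calc _ ≤ Real.exp (c * r) * (Real.exp (-(c * r)) * (Real.exp (c * s) * ‖x s‖ + c * I)) := by
          gcongr
      _ = _ := by rw [← mul_assoc, ← Real.exp_add]; simp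
  refine (pi_norm_le_iff_of_nonneg (by positivity)).2 fun i => ?_
  have hD := exp_mul_sub_exp_mul_eq_integral (y := fun u => x u i) c hr.1
    (hx.intervalIntegrable_drift hA hs hr.1 i)
    (fun u hu => hx.eq_add_integral hA hs hu.1 i)
  have hbound : |∫ u in s..r, Real.exp (c * u) *
      (c * x u i + (∑ k, A u i k * x u k - (∑ k, |A u i k|) * x u i))| ≤ c * I := by
    rw [hI, ← intervalIntegral.integral_const_mul, ← Real.norm_eq_abs]
    refine intervalIntegral.norm_integral_le_of_norm_le hr.1 (ae_of_all _ fun u hu => ?_)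
      ((hcont.const_mul c).intervalIntegrable _ _)
    have hu0 : 0 ≤ u := hs.trans hu.1.le
    rw [max_eq_left hu0, norm_mul, Real.norm_of_nonneg (Real.exp_pos _).le, mul_left_comm]
    refine mul_le_mul_of_nonneg_left ?_ (Real.exp_pos _).le
    have hxk : ∀ k, |x u k| ≤ ‖x u‖ := fun k => norm_le_pi_norm (x u) k
    have h1 : |∑ k, A u i k * x u k| ≤ (∑ k, |A u i k|) * ‖x u‖ := by
      rw [Finset.sum_mul]
      refine (Finset.abs_sum_le_sum_abs _ _).trans (Finset.sum_le_sum fun k _ => ?_)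
      rw [abs_mul]
      exact mul_le_mul_of_nonneg_left (hxk k) (abs_nonneg _)
    have h2 : |(c - ∑ k, |A u i k|) * x u i| ≤ (c - ∑ k, |A u i k|) * ‖x u‖ := by
      have := sub_nonneg.2 (hAc u hu0 i)
      rw [abs_mul, abs_of_nonneg this]
      exact mul_le_mul_of_nonneg_left (hxk i) this
    rw [Real.norm_eq_abs, show c * x u i + (∑ k, A u i k * x u k - (∑ k, |A u i k|) * x u i)
      = (c - ∑ k, |A u i k|) * x u i + ∑ k, A u i k * x u k by ring]
    refine (abs_add_le _ _).trans ?_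
    linarith
  have hxs : |x s i| ≤ ‖x s‖ := norm_le_pi_norm (x s) i
  rw [Real.exp_neg, inv_mul_eq_div, le_div_iff₀ (Real.exp_pos _), Real.norm_eq_abs]
  calc |x r i| * Real.exp (c * r) = |Real.exp (c * r) * x r i| := by
        rw [abs_mul, abs_of_pos (Real.exp_pos _), mul_comm]
    _ ≤ |Real.exp (c * s) * x s i| + c * I := by
        rw [← hD] at hbound
        have := abs_add_le (Real.exp (c * s) * x s i)
          (Real.exp (c * r) * x r i - Real.exp (c * s) * x s i)
        rw [add_sub_cancel] at this
        linarith
    _ ≤ _ := by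
        rw [abs_mul, abs_of_pos (Real.exp_pos _)]
        gcongr

/-- Growth of the gap between a bound `M` on the moduli and the modulus of an opinion, when the
neighbour `k` of `i` keeps a gap of at least `η`. -/
lemma IsSolution.add_le_exp_mul_gap (hA : IsAdjacency A) (hx : IsSolution A x) {c : ℝ}
    (hc : 0 ≤ c) (hAc : ∀ r ≥ 0, ∀ i, ∑ k, |A r i k| ≤ c) {s t M η : ℝ}
    (hs : 0 ≤ s) (hst : s ≤ t) (hM : ‖x s‖ ≤ M) (hη : 0 ≤ η) (i k : Fin N)
    (hk : ∀ r ∈ Set.Icc s t, |x r k| ≤ M - η) :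
    Real.exp (c * s) * (M - |x s i|) + Real.exp (c * s) * η * ∫ r in s..t, |A r i k|
      ≤ Real.exp (c * t) * (M - |x t i|) := by
  obtain ⟨σ, hσ, hσt⟩ : ∃ σ : ℝ, |σ| = 1 ∧ |x t i| = σ * x t i := by
    rcases abs_choice (x t i) with h | h
    · exact ⟨1, by simp, by simpa using h⟩
    · exact ⟨-1, by simp, by simpa using h⟩
  have hσle : ∀ z : ℝ, σ * z ≤ |z| := fun z => by
    simpa [abs_mul, hσ] using le_abs_self (σ * z)
  have hdrift := hx.intervalIntegrable_drift hA hs hst i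
  have hD := exp_mul_sub_exp_mul_eq_integral (y := fun u => M - σ * x u i) c hst
    (hdrift.const_mul (-σ)) (fun u hu => by
      rw [intervalIntegral.integral_const_mul, hx.eq_add_integral hA hs hu.1 i]
      ring)
  have hle : ∫ r in s..t, Real.exp (c * s) * η * |A r i k| ≤ ∫ r in s..t, Real.exp (c * r) *
      (c * (M - σ * x r i) + -σ * (∑ k, A r i k * x r k - (∑ k, |A r i k|) * x r i)) := by
    refine intervalIntegral.integral_mono_on hst
      ((hA.intervalIntegrable hs hst i k).abs.const_mul _) ?_ fun r hr => ?_
    · have hxc : ContinuousOn (fun r => c * (M - σ * x r i)) (Set.uIcc s t) := by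
        have := (hx.continuousOn_apply i).mono (s := Set.Ici 0) (t := Set.uIcc s t) fun r hr => by
          rw [Set.uIcc_of_le hst] at hr; exact hs.trans hr.1
        fun_prop
      exact (hxc.intervalIntegrable.add (hdrift.const_mul (-σ))).continuousOn_mul (by fun_prop)
    · have hr0 : 0 ≤ r := hs.trans hr.1
      have hxM : ∀ m, |x r m| ≤ M := fun m =>
        ((norm_le_pi_norm (x r) m).trans (hx.norm_le_norm hA hc hAc hs hr.1)).trans hM
      have hsum : |A r i k| * η ≤ ∑ m, (|A r i m| * M - σ * (A r i m * x r m)) := by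
        have hterm : ∀ m, |A r i m| * (M - |x r m|) ≤
            |A r i m| * M - σ * (A r i m * x r m) := fun m => by
          have := hσle (A r i m * x r m)
          rw [abs_mul] at this
          linarith
        calc |A r i k| * η ≤ |A r i k| * (M - |x r k|) :=
              mul_le_mul_of_nonneg_left (by linarith [hk r hr]) (abs_nonneg _)
          _ ≤ |A r i k| * M - σ * (A r i k * x r k) := hterm k
          _ ≤ _ := Finset.single_le_sum
              (f := fun m => |A r i m| * M - σ * (A r i m * x r m))
              (fun m _ => (mul_nonneg (abs_nonneg _) (sub_nonneg.2 (hxM m))).trans (hterm m))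
              (Finset.mem_univ k)
      rw [Finset.sum_sub_distrib, ← Finset.sum_mul, ← Finset.mul_sum] at hsum
      have hself : 0 ≤ (c - ∑ m, |A r i m|) * (M - σ * x r i) :=
        mul_nonneg (sub_nonneg.2 (hAc r hr0 i))
          (sub_nonneg.2 ((hσle _).trans (hxM i)))
      rw [mul_assoc]
      refine mul_le_mul (Real.exp_le_exp.2 (mul_le_mul_of_nonneg_left hr.1 hc)) ?_
        (by positivity) (Real.exp_pos _).le
      linarith
  rw [← hD, intervalIntegral.integral_const_mul] at hle
  have hxs : Real.exp (c * s) * (M - |x s i|) ≤ Real.exp (c * s) * (M - σ * x s i) :=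
    mul_le_mul_of_nonneg_left (by linarith [hσle (x s i)]) (Real.exp_pos _).le
  rw [hσt]
  linarith

/-- Over a time span `τ`, a gap shrinks at most by the factor `e^{-cτ}`. -/
lemma IsSolution.abs_le_sub_exp_mul (hA : IsAdjacency A) (hx : IsSolution A x) {c : ℝ}
    (hc : 0 ≤ c) (hAc : ∀ r ≥ 0, ∀ i, ∑ k, |A r i k| ≤ c) {s t M η τ : ℝ}
    (hs : 0 ≤ s) (hst : s ≤ t) (htτ : t ≤ s + τ) (hM : ‖x s‖ ≤ M) (hη : 0 ≤ η) (i : Fin N)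
    (hi : |x s i| ≤ M - η) : |x t i| ≤ M - Real.exp (-(c * τ)) * η := by
  have h := hx.add_le_exp_mul_gap hA hc hAc hs hst hM le_rfl i i fun r hr => by
    simpa using (norm_le_pi_norm (x r) i).trans ((hx.norm_le_norm hA hc hAc hs hr.1).trans hM)
  rw [mul_zero, zero_mul, add_zero] at h
  have h1 : Real.exp (c * t) * (Real.exp (-(c * τ)) * η) ≤ Real.exp (c * t) * (M - |x t i|) := by
    refine le_trans ?_ h
    rw [← mul_assoc, ← Real.exp_add]
    refine mul_le_mul (Real.exp_le_exp.2 ?_) (by linarith) hη (Real.exp_pos _).le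
    nlinarith
  linarith [le_of_mul_le_mul_left h1 (Real.exp_pos _)]

/-- A reachability chain leaving a set crosses its boundary. -/
lemma Relation.ReflTransGen.exists_mem_notMem {α : Type*} {r : α → α → Prop} {S : Set α} {u v : α}
    (h : Relation.ReflTransGen r u v) (hu : u ∈ S) (hv : v ∉ S) :
    ∃ a ∈ S, ∃ b ∉ S, r a b := by
  induction h with
  | refl => exact absurd hu hv
  | @tail b d _ hbd ih =>
    by_cases hb : b ∈ S
    · exact ⟨b, hb, d, hv, hbd⟩
    · exact ih hb

/-- Along a uniformly strongly connected graph, the set of opinions keeping a gap gains a node in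
every time window until it is everything. -/
lemma IsSolution.exists_card_abs_le (hA : IsAdjacency A) (hx : IsSolution A x) {c : ℝ}
    (hc : 0 ≤ c) (hAc : ∀ r ≥ 0, ∀ i, ∑ k, |A r i k| ≤ c) {T ε : ℝ} (hT : 0 ≤ T) (hε : 0 ≤ ε)
    (hconn : ∀ t ≥ (0:ℝ), ∀ u v : Fin N,
      Relation.ReflTransGen (fun k j => ε ≤ ∫ s in t..(t + T), |A s j k|) u v)
    {s M η : ℝ} (hs : 0 ≤ s) (hM : ‖x s‖ ≤ M) (hη : 0 ≤ η) (i : Fin N)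
    (hi : |x s i| ≤ M - η) (n : ℕ) :
    ∃ S : Finset (Fin N), i ∈ S ∧ min (n + 1) N ≤ S.card ∧ ∀ j ∈ S,
      |x (s + n * T) j| ≤ M - η * (min 1 ε * Real.exp (-(2 * c * T))) ^ n := by
  have hγ : 0 ≤ min 1 ε * Real.exp (-(2 * c * T)) :=
    mul_nonneg (le_min zero_le_one hε) (Real.exp_pos _).le
  induction n with
  | zero => exact ⟨{i}, by simp, by simp, by simpa using hi⟩
  | succ n ih =>
    obtain ⟨S, hiS, hcard, hS⟩ := ih
    set t := s + n * T with ht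
    have hst : s ≤ t := by simp only [ht]; nlinarith [n.cast_nonneg (α := ℝ)]
    have ht0 : 0 ≤ t := hs.trans hst
    have htM : ‖x t‖ ≤ M := (hx.norm_le_norm hA hc hAc hs hst).trans hM
    set θ := η * (min 1 ε * Real.exp (-(2 * c * T))) ^ n with hθ
    have hθ0 : 0 ≤ θ := mul_nonneg hη (pow_nonneg hγ n)
    have htT : t ≤ t + T := by linarith
    rw [show s + ((n + 1 : ℕ) : ℝ) * T = t + T by push_cast; ring, pow_succ, ← mul_assoc, ← hθ]
    have hE : Real.exp (-(2 * c * T)) = Real.exp (-(c * T)) * Real.exp (-(c * T)) := by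
      rw [← Real.exp_add]; congr 1; ring
    have hE1 : Real.exp (-(c * T)) ≤ 1 := Real.exp_le_one_iff.2 (by nlinarith)
    have hstay : ∀ j ∈ S, |x (t + T) j| ≤
        M - θ * (min 1 ε * Real.exp (-(2 * c * T))) := fun j hj => by
      have h1 := hx.abs_le_sub_exp_mul hA hc hAc ht0 htT le_rfl htM hθ0 j (hS j hj)
      have h2 : min 1 ε * Real.exp (-(2 * c * T)) ≤ Real.exp (-(c * T)) := by
        rw [hE]
        calc _ ≤ 1 * (1 * Real.exp (-(c * T))) := by gcongr; exact min_le_left _ _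
          _ = _ := by ring
      nlinarith [mul_le_mul_of_nonneg_left h2 hθ0]
    by_cases hfull : ∃ v, v ∉ S
    · obtain ⟨v, hv⟩ := hfull
      obtain ⟨k, hk, j, hj, hkj⟩ := (hconn t ht0 i v).exists_mem_notMem (S := (S : Set (Fin N)))
        (by simpa using hiS) (by simpa using hv)
      replace hk : k ∈ S := by simpa using hk
      replace hj : j ∉ S := by simpa using hj
      refine ⟨insert j S, Finset.mem_insert_of_mem hiS, ?_, ?_⟩
      · rw [Finset.card_insert_of_notMem hj]; omega
      · intro l hl
        rcases Finset.mem_insert.1 hl with rfl | hl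
        · have hgap := hx.add_le_exp_mul_gap hA hc hAc ht0 htT htM
            (mul_nonneg (Real.exp_pos (-(c * T))).le hθ0) l k fun r hr =>
              hx.abs_le_sub_exp_mul hA hc hAc ht0 hr.1 hr.2 htM hθ0 k (hS k hk)
          have h0 : 0 ≤ Real.exp (c * t) * (M - |x t l|) :=
            mul_nonneg (Real.exp_pos _).le
              (sub_nonneg.2 ((norm_le_pi_norm (x t) l).trans htM))
          have h1 : Real.exp (c * (t + T)) * (θ * (min 1 ε * Real.exp (-(2 * c * T))))
              ≤ Real.exp (c * (t + T)) * (M - |x (t + T) l|) := by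
            calc _ = Real.exp (c * t) * (Real.exp (-(c * T)) * θ) * min 1 ε := by
                  rw [show Real.exp (c * t) = Real.exp (c * (t + T)) * Real.exp (-(c * T)) by
                    rw [← Real.exp_add]; congr 1; ring, hE]
                  ring
              _ ≤ Real.exp (c * t) * (Real.exp (-(c * T)) * θ) * ∫ r in t..(t + T), |A r l k| := by
                  gcongr
                  exact (min_le_right _ _).trans hkj
              _ ≤ _ := by linarith
          linarith [le_of_mul_le_mul_left h1 (Real.exp_pos _)]
        · exact hstay l hl
    · push Not at hfull
      refine ⟨S, hiS, ?_, hstay⟩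
      rw [Finset.eq_univ_of_forall hfull]
      simp

end Protocol

/-- bounded entries and uniform strong connectivity imply modulus consensus. -/
theorem stmt10 {N : ℕ} (hN : 2 ≤ N) (A : ℝ → Matrix (Fin N) (Fin N) ℝ)
    (hA : IsAdjacency A) (hbdd : ∃ R : ℝ, ∀ t ≥ (0:ℝ), ∀ j k, |A t j k| ≤ R)
    (hUSC : USC A) : ModulusConsensus A := by
  intro x hx
  obtain ⟨R, hR⟩ := hbdd
  obtain ⟨T, hT, ε, hε, hconn⟩ := hUSC
  have hAc : ∀ r ≥ 0, ∀ i, ∑ k, |A r i k| ≤ N * |R| := fun r hr i => by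
    simpa using Finset.sum_le_card_nsmul Finset.univ (fun k => |A r i k|) |R|
      fun k _ => (hR r hr i k).trans (le_abs_self R)
  have hc : 0 ≤ N * |R| := by positivity
  generalize (N : ℝ) * |R| = c at hAc hc
  have hanti : ∀ {s t : ℝ}, 0 ≤ s → s ≤ t → ‖x t‖ ≤ ‖x s‖ := fun hs hst =>
    hx.norm_le_norm hA hc hAc hs hst
  set m := ⨅ r : ℝ, ‖x (max r 0)‖ with hm
  have hbelow : BddBelow (Set.range fun r : ℝ => ‖x (max r 0)‖) :=
    ⟨0, by rintro _ ⟨r, rfl⟩; exact norm_nonneg _⟩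
  have hmle : ∀ r ≥ 0, m ≤ ‖x r‖ := fun r hr => by
    simpa [max_eq_left hr] using ciInf_le hbelow r
  have hlim : Tendsto (fun r => ‖x r‖) atTop (𝓝 m) := by
    have hmono : Antitone fun r : ℝ => ‖x (max r 0)‖ := fun a b hab =>
      hanti (le_max_right _ _) (max_le_max_right 0 hab)
    refine (tendsto_atTop_ciInf hmono hbelow).congr' ?_
    filter_upwards [eventually_ge_atTop 0] with r hr
    rw [max_eq_left hr]
  refine ⟨m, Real.iInf_nonneg fun r => norm_nonneg _, fun i => ?_⟩
  have hupper : ∀ r, |x r i| ≤ ‖x r‖ := fun r => norm_le_pi_norm (x r) i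
  refine tendsto_order.2 ⟨fun a ha => ?_, fun a ha => ?_⟩
  · set κ := (m - a) * (min 1 ε * Real.exp (-(2 * c * T))) ^ N with hκ
    have hκ0 : 0 < κ :=
      mul_pos (sub_pos.2 ha) (pow_pos (mul_pos (lt_min one_pos hε) (Real.exp_pos _)) N)
    filter_upwards [hlim.eventually (gt_mem_nhds (lt_add_of_pos_right m hκ0)),
      eventually_ge_atTop 0] with s hsκ hs
    by_contra! hle
    obtain ⟨S, -, hcard, hS⟩ := hx.exists_card_abs_le hA hc hAc hT.le hε.le hconn hs le_rfl
      (sub_nonneg.2 ha.le) i (by linarith [hmle s hs]) N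
    have hSuniv : S = Finset.univ := by
      rw [← Finset.card_eq_iff_eq_univ, Fintype.card_fin]
      have := S.card_le_univ
      rw [Fintype.card_fin] at this
      omega
    have hlast := hmle (s + N * T) (by positivity)
    obtain ⟨j, hj⟩ : ∃ j, ‖x (s + N * T)‖ ≤ |x (s + N * T) j| := by
      by_contra! hlt
      have : 0 < ‖x (s + N * T)‖ := (abs_nonneg _).trans_lt (hlt i)
      exact lt_irrefl _ ((pi_norm_lt_iff this).2 hlt)
    have := hS j (hSuniv ▸ Finset.mem_univ j)
    linarith
  · filter_upwards [hlim.eventually (gt_mem_nhds ha)] with r hr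
    exact (hupper r).trans_lt hr
end
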